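/- If 0 < λ < 1/√(8K) and u is a solution of equation (wff) with parameter λ, then ‖u‖_Y < 2λ², i.e., ((1/(2π)) ∫₀^{2π} u(s)² ds)^{1/2} < 2λ². -/

import Mathlib

open Real in
/-- `u` is a solution of equation (wff) with parameter `λ = lam`: a `C²`,
`2π`-periodic function with zero mean on `[0, 2π]` satisfying
`u'' + λΓu' + λ²sin(z+u) = λ²·(1/2π)∫₀^{2π} sin(s+u(s)) ds
 + λ²K[u(z+2πm/n) − 2u(z) + u(z−2πm/n)]`. -/
def WffSolution (n m : ℕ) (Γ K lam : ℝ) (u : ℝ → ℝ) : Prop :=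
  ContDiff ℝ 2 u ∧
  (∀ z : ℝ, u (z + 2 * π) = u z) ∧
  (∫ s in (0:ℝ)..(2 * π), u s) = 0 ∧
  (∀ z : ℝ, deriv (deriv u) z + lam * Γ * deriv u z + lam ^ 2 * Real.sin (z + u z)
      = lam ^ 2 * (1 / (2 * π)) * (∫ s in (0:ℝ)..(2 * π), Real.sin (s + u s))
        + lam ^ 2 * K * (u (z + 2 * π * m / n) - 2 * u z + u (z - 2 * π * m / n)))

open Real MeasureTheory in
/-- **Wirtinger's inequality** for `C¹`, `2π`-periodic functions of zero mean. -/
theorem integral_sq_le_integral_deriv_sq {u : ℝ → ℝ} (hu : ContDiff ℝ 1 u)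
    (hper : u (2 * π) = u 0) (hmean : ∫ s in (0:ℝ)..(2 * π), u s = 0) :
    ∫ s in (0:ℝ)..(2 * π), (u s) ^ 2 ≤ ∫ s in (0:ℝ)..(2 * π), (deriv u s) ^ 2 := by
  have hab : (0:ℝ) < 2 * π := by positivity
  have hc' : Continuous (deriv u) := hu.continuous_deriv_one
  have memLp : ∀ f : ℝ → ℝ, Continuous f →
      MemLp (fun x => (f x : ℂ)) 2 (volume.restrict (Set.Ioc 0 (2 * π))) := fun f hf =>
    have hf' : Continuous fun x => (f x : ℂ) := Complex.continuous_ofReal.comp hf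
    (memLp_two_iff_integrable_sq_norm hf'.aestronglyMeasurable).2
      ((hf'.norm.pow 2).integrableOn_Ioc)
  have parseval_u := hasSum_sq_fourierCoeffOn hab (memLp u hu.continuous)
  have parseval_deriv := hasSum_sq_fourierCoeffOn hab (memLp (deriv u) hc')
  have coeff_le : ∀ k : ℤ, ‖fourierCoeffOn hab (fun x => (u x : ℂ)) k‖ ^ 2
      ≤ ‖fourierCoeffOn hab (fun x => ((deriv u x : ℝ) : ℂ)) k‖ ^ 2 := by
    intro k
    rcases eq_or_ne k 0 with rfl | hk
    · have : fourierCoeffOn hab (fun x => (u x : ℂ)) 0 = 0 := by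
        rw [fourierCoeffOn_eq_integral]
        simp [intervalIntegral.integral_ofReal, hmean]
      rw [this]
      simp
    · have h := fourierCoeffOn_of_hasDerivAt hab hk
        (fun x _ => ((hu.differentiable one_ne_zero x).hasDerivAt).ofReal_comp)
        ((Complex.continuous_ofReal.comp hc').intervalIntegrable _ _)
      have hk1 : (1:ℝ) ≤ |(k:ℝ)| := by exact_mod_cast Int.one_le_abs hk
      gcongr
      rw [h, hper]
      simp only [sub_self, mul_zero, zero_sub, norm_mul, norm_neg, norm_div, norm_one,
        Complex.norm_I, Complex.norm_intCast]
      have hn : ‖((2 * π : ℝ) : ℂ) - ((0:ℝ) : ℂ)‖ = 2 * π := by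
        rw [← Complex.ofReal_sub, Complex.norm_real, sub_zero, norm_of_nonneg hab.le]
      have hp : ‖(π : ℂ)‖ = π := by rw [Complex.norm_real, norm_of_nonneg pi_pos.le]
      rw [hn, hp, Complex.norm_ofNat]
      have hpos : 0 < |(k:ℝ)| := by linarith
      calc 1 / (2 * π * 1 * |(k:ℝ)|) * (2 * π * _)
          = ‖fourierCoeffOn hab (fun x => ((deriv u x : ℝ) : ℂ)) k‖ / |(k:ℝ)| := by
            field_simp
        _ ≤ _ := div_le_self (norm_nonneg _) hk1
  have h := hasSum_le coeff_le parseval_u parseval_deriv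
  simp only [Complex.norm_real, norm_eq_abs, sq_abs, smul_eq_mul, sub_zero] at h
  exact le_of_mul_le_mul_left h (by positivity)

open Real in
/-- The energy estimate obtained by testing (wff) against `u`. -/
theorem WffSolution.integral_deriv_sq_le {n m : ℕ} {Γ K lam : ℝ} (hK : 0 < K) (hlam : 0 < lam)
    {u : ℝ → ℝ} (hu : WffSolution n m Γ K lam u) :
    ∫ s in (0:ℝ)..(2 * π), (deriv u s) ^ 2
      ≤ 2 * π * lam ^ 4 + (1 / 4 + 4 * lam ^ 2 * K) * ∫ s in (0:ℝ)..(2 * π), (u s) ^ 2 := by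
  obtain ⟨hC, hper, hmean, heq⟩ := hu
  set c : ℝ := lam ^ 2 * (1 / (2 * π)) * ∫ s in (0:ℝ)..(2 * π), Real.sin (s + u s)
  set d : ℝ := 2 * π * m / n
  have hC' : ContDiff ℝ 1 (deriv u) := hC.deriv' (n := 1)
  have hcu : Continuous u := hC.continuous
  have hcu' : Continuous (deriv u) := hC'.continuous
  have hcu'' : Continuous (deriv (deriv u)) := hC'.continuous_deriv_one
  have hd : ∀ x, HasDerivAt u (deriv u x) x := fun x =>
    (hC.differentiable two_ne_zero x).hasDerivAt
  have hd' : ∀ x, HasDerivAt (deriv u) (deriv (deriv u) x) x := fun x =>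
    (hC'.differentiable one_ne_zero x).hasDerivAt
  have hper' : ∀ z, deriv u (z + 2 * π) = deriv u z := fun z => by
    rw [← deriv_comp_add_const, funext hper]
  set G : ℝ → ℝ := fun x =>
    (deriv u x * deriv u x + u x * deriv (deriv u) x) + lam * Γ * (u x * deriv u x)
  have hG : ∫ s in (0:ℝ)..(2 * π), G s = 0 := by
    rw [intervalIntegral.integral_eq_sub_of_hasDerivAt
      (f := fun x => u x * deriv u x + lam * Γ * (u x ^ 2 / 2))]
    · have h₀ := hper 0
      have h₁ := hper' 0
      rw [zero_add] at h₀ h₁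
      simp [h₀, h₁]
    · intro x _
      refine (((hd x).mul (hd' x)).add
        ((((hd x).pow 2).div_const 2).const_mul (lam * Γ))).congr_deriv ?_
      simp only [G]
      push_cast
      ring
    · exact Continuous.intervalIntegrable (by fun_prop) _ _
  have hshift : ∀ a : ℝ, ∫ s in (0:ℝ)..(2 * π), (u (s + a)) ^ 2
      = ∫ s in (0:ℝ)..(2 * π), (u s) ^ 2 := fun a => by
    have hp : Function.Periodic (fun s => (u s) ^ 2) (2 * π) := fun z => by simp [hper z]
    have h := hp.intervalIntegral_add_eq a 0
    rw [intervalIntegral.integral_comp_add_right (fun s => (u s) ^ 2)]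
    simpa [add_comm] using h
  have hpt : ∀ z, (deriv u z) ^ 2 ≤ G z - c * u z + lam ^ 4 + (1 / 4 + 3 * lam ^ 2 * K) * u z ^ 2
      + lam ^ 2 * K / 2 * u (z + d) ^ 2 + lam ^ 2 * K / 2 * u (z + -d) ^ 2 := by
    intro z
    have h := heq z
    rw [sub_eq_add_neg z d] at h
    have hs : lam ^ 2 * (u z * sin (z + u z)) ≤ lam ^ 4 + u z ^ 2 / 4 := by
      nlinarith [sq_nonneg (lam ^ 2 * sin (z + u z) - u z / 2),
        mul_le_mul_of_nonneg_left (sin_sq_le_one (z + u z)) (by positivity : 0 ≤ lam ^ 4)]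
    have hlK : 0 ≤ lam ^ 2 * K := by positivity
    have h₁ := mul_nonneg hlK (sq_nonneg (u z + u (z + d)))
    have h₂ := mul_nonneg hlK (sq_nonneg (u z + u (z + -d)))
    have h₃ : deriv (deriv u) z = c + lam ^ 2 * K * (u (z + d) - 2 * u z + u (z + -d))
        - lam * Γ * deriv u z - lam ^ 2 * sin (z + u z) := by linarith
    simp only [G]
    rw [h₃]
    linarith
  have hint := intervalIntegral.integral_mono (μ := MeasureTheory.volume)
    (by positivity : (0:ℝ) ≤ 2 * π)
    (Continuous.intervalIntegrable (by fun_prop) _ _)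
    (Continuous.intervalIntegrable (by fun_prop) _ _) hpt
  have hi : ∀ {f : ℝ → ℝ}, Continuous f → IntervalIntegrable f MeasureTheory.volume 0 (2 * π) :=
    fun hf => hf.intervalIntegrable _ _
  rw [intervalIntegral.integral_add (hi (by fun_prop)) (hi (by fun_prop)),
    intervalIntegral.integral_add (hi (by fun_prop)) (hi (by fun_prop)),
    intervalIntegral.integral_add (hi (by fun_prop)) (hi (by fun_prop)),
    intervalIntegral.integral_add (hi (by fun_prop)) (hi (by fun_prop)),
    intervalIntegral.integral_sub (hi (by fun_prop)) (hi (by fun_prop))] at hint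
  simp only [intervalIntegral.integral_const_mul, intervalIntegral.integral_const, hshift, hG,
    hmean, smul_eq_mul] at hint
  linarith

open Real in
/-- If `0 < λ < 1/√(8K)` and `u` solves (wff) with parameter `λ`, then
`‖u‖_Y < 2λ²`. -/
theorem norm_lt_of_small_lambda (n m : ℕ) (hn : 1 ≤ n) (hm : 1 ≤ m)
    (Γ K lam : ℝ) (hΓ : 0 < Γ) (hK : 0 < K)
    (hlam : 0 < lam) (hlam' : lam < 1 / Real.sqrt (8 * K))
    (u : ℝ → ℝ) (hu : WffSolution n m Γ K lam u) :
    Real.sqrt ((1 / (2 * π)) * ∫ s in (0:ℝ)..(2 * π), (u s) ^ 2)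
      < 2 * lam ^ 2 := by
  have hmean := hu.2.2.1
  have hper : u (2 * π) = u 0 := by simpa using hu.2.1 0
  have hW := integral_sq_le_integral_deriv_sq (hu.1.of_le one_le_two) hper hmean
  have hE := hu.integral_deriv_sq_le hK hlam
  have hK8 : lam ^ 2 * K < 1 / 8 := by
    rw [lt_div_iff₀ (by positivity)] at hlam'
    have h := pow_lt_pow_left₀ hlam' (by positivity) two_ne_zero
    rw [mul_pow, sq_sqrt (by positivity)] at h
    linarith
  set A := ∫ s in (0:ℝ)..(2 * π), (u s) ^ 2
  have hA : 0 ≤ A := intervalIntegral.integral_nonneg (by positivity) fun _ _ => sq_nonneg _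
  have hlt : A < 2 * π * (4 * lam ^ 4) := by
    rcases hA.eq_or_lt with h | h
    · rw [← h]
      positivity
    · linarith [mul_lt_mul_of_pos_right hK8 h]
  rw [sqrt_lt' (by positivity), one_div, inv_mul_lt_iff₀ (by positivity)]
  linarith
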